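/- Existence of a Boy-type halfway model: there exists a smooth immersion f : S² → ℝ³ such that f(−x) = f(x) for every x ∈ S². (Such an f is a double cover of an immersed real projective plane in ℝ³, i.e. a Boy's surface.) -/

import Mathlib

open Metric Manifold

noncomputable section

/-- Euclidean 3-space. -/
abbrev E3 : Type := EuclideanSpace ℝ (Fin 3)

/-- The unit 2-sphere in Euclidean 3-space, with its standard smooth structure. -/
abbrev S2 : Type := Metric.sphere (0 : E3) 1

/-- A smooth immersion of the sphere into 3-space: a smooth map whose manifold
differential is injective at every point. -/
def IsImmersion (f : S2 → E3) : Prop :=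
  ContMDiff (𝓡 2) 𝓘(ℝ, E3) (⊤ : ℕ∞) f ∧
    ∀ x : S2, Function.Injective (mfderiv (𝓡 2) 𝓘(ℝ, E3) f x)

/-- A regular homotopy between `f` and `g`: a smooth map `H : [0,1] × S² → ℝ³`
with `H(0,·) = f`, `H(1,·) = g`, such that each `H(t,·)` is an immersion. -/
def RegularHomotopic (f g : S2 → E3) : Prop :=
  ∃ H : Set.Icc (0 : ℝ) 1 × S2 → E3,
    ContMDiff ((𝓡∂ 1).prod (𝓡 2)) 𝓘(ℝ, E3) (⊤ : ℕ∞) H ∧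
    (∀ x : S2, H (⟨0, by norm_num⟩, x) = f x) ∧
    (∀ x : S2, H (⟨1, by norm_num⟩, x) = g x) ∧
    (∀ t : Set.Icc (0 : ℝ) 1, IsImmersion (fun x : S2 => H (t, x)))


namespace Boy

def s : ℂ := ((Real.sqrt 5 : ℝ) : ℂ)

lemma s_sq : s ^ 2 = 5 := by
  unfold s
  rw [← Complex.ofReal_pow, Real.sq_sqrt (by norm_num)]; norm_num

def D (w : ℂ) : ℂ := w ^ 6 + s * w ^ 3 - 1
def D' (w : ℂ) : ℂ := 6 * w ^ 5 + s * (3 * w ^ 2)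

def N (k : Fin 3) (w : ℂ) : ℂ :=
  ![(3 / 2) * Complex.I * (w - w ^ 5), -(3 / 2) * (w + w ^ 5),
    -Complex.I * (1 + w ^ 6) - (1 / 2) * D w] k

def N' (k : Fin 3) (w : ℂ) : ℂ :=
  ![(3 / 2) * Complex.I * (1 - 5 * w ^ 4), -(3 / 2) * (1 + 5 * w ^ 4),
    -Complex.I * (6 * w ^ 5) - (1 / 2) * D' w] k

def M (w : ℂ) : ℂ :=
  -(w ^ 6 - s * w ^ 3 - 1) + Complex.I * (1 + w ^ 6) + (1 / 4) * D w

def G (k : Fin 3) (w : ℂ) : ℝ := (N k w).re * (D w).re + (N k w).im * (D w).im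

def Q (w : ℂ) : ℝ :=
  ((N 0 w).re ^ 2 + (N 0 w).im ^ 2) + ((N 1 w).re ^ 2 + (N 1 w).im ^ 2)
    + ((N 2 w).re ^ 2 + (N 2 w).im ^ 2) + ((M w).re * (D w).re + (M w).im * (D w).im)

def h (w : ℂ) : E3 := WithLp.toLp 2 (fun k => 2 * G k w / Q w)

lemma hasDerivAt_D (w : ℂ) : HasDerivAt D (D' w) w := by
  have h1 := ((hasDerivAt_pow 6 w).add ((hasDerivAt_pow 3 w).const_mul s)).sub_const 1
  exact h1.congr_deriv (by simp [D'])

lemma hasDerivAt_N (k : Fin 3) (w : ℂ) : HasDerivAt (N k) (N' k w) w := by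
  fin_cases k
  · have h1 := ((hasDerivAt_id w).sub (hasDerivAt_pow 5 w)).const_mul ((3 / 2) * Complex.I)
    exact h1.congr_deriv (by simp [N'])
  · have h1 := ((hasDerivAt_id w).add (hasDerivAt_pow 5 w)).const_mul (-(3 / 2) : ℂ)
    exact h1.congr_deriv (by simp [N'])
  · have h1 := (((hasDerivAt_pow 6 w).const_add 1).const_mul (-Complex.I)).sub
      ((hasDerivAt_D w).const_mul (1 / 2 : ℂ))
    exact h1.congr_deriv (by simp [N'])

lemma N_sq (w : ℂ) : N 0 w ^ 2 + N 1 w ^ 2 + N 2 w ^ 2 = D w * M w := by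
  have hs := s_sq
  have hI : Complex.I ^ 2 = -1 := Complex.I_sq
  simp only [N, M, D, Matrix.cons_val]
  linear_combination (9 / 4 * (w - w ^ 5) ^ 2 + (1 + w ^ 6) ^ 2) * hI - w ^ 6 * hs

/-- The Wronskian. -/
def W (k : Fin 3) (w : ℂ) : ℂ := N' k w * D w - N k w * D' w

lemma W_sq (w : ℂ) : W 0 w ^ 2 + W 1 w ^ 2 + W 2 w ^ 2 = 0 := by
  have hs := s_sq
  have hI : Complex.I ^ 2 = -1 := Complex.I_sq
  have h0 : W 0 w = (3 / 2) * Complex.I *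
      (-(s * w ^ 3 + 1) ^ 2 + w ^ 4 * (w ^ 3 - s) ^ 2) := by
    simp only [W, N, N', D, D', Matrix.cons_val]
    linear_combination (3 / 2) * Complex.I * (w ^ 6 - w ^ 4) * hs
  have h1 : W 1 w = -(3 / 2) *
      (-(s * w ^ 3 + 1) ^ 2 - w ^ 4 * (w ^ 3 - s) ^ 2) := by
    simp only [W, N, N', D, D', Matrix.cons_val]
    linear_combination -(3 / 2) * (w ^ 6 + w ^ 4) * hs
  have h2 : W 2 w = -Complex.I * (3 * w ^ 2 * (s * w ^ 3 + 1) * (w ^ 3 - s)) := by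
    simp only [W, N, N', D, D', Matrix.cons_val]
    linear_combination -Complex.I * 3 * w ^ 5 * hs
  rw [h0, h1, h2]
  linear_combination ((3 / 2) ^ 2 * (-(s * w ^ 3 + 1) ^ 2 + w ^ 4 * (w ^ 3 - s) ^ 2) ^ 2
    + (3 * w ^ 2 * (s * w ^ 3 + 1) * (w ^ 3 - s)) ^ 2) * hI

lemma W_ne (w : ℂ) (hD : D w ≠ 0) (h0 : W 0 w = 0) (h1 : W 1 w = 0) : False := by
  have hI : Complex.I ^ 2 = -1 := Complex.I_sq
  simp only [W, N, N', Matrix.cons_val] at h0 h1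
  have e1 : D w - w * D' w = 0 := by
    linear_combination (-Complex.I / 3) * h0 - (1 / 3) * h1 +
      (1 / 2) * ((1 - 5 * w ^ 4) * D w - (w - w ^ 5) * D' w) * hI
  have e2 : 5 * w ^ 4 * D w - w ^ 5 * D' w = 0 := by
    linear_combination (Complex.I / 3) * h0 - (1 / 3) * h1 -
      (1 / 2) * ((1 - 5 * w ^ 4) * D w - (w - w ^ 5) * D' w) * hI
  have e3 : w ^ 4 * D w = 0 := by linear_combination (1 / 4) * e2 - (1 / 4) * w ^ 4 * e1
  have e4 : w = 0 := by
    rcases mul_eq_zero.1 e3 with h | h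
    · exact pow_eq_zero_iff (by norm_num) |>.1 h
    · exact absurd h hD
  apply hD
  rw [e4] at e1 ⊢
  simpa using e1

lemma N_ne (w : ℂ) (hD : D w = 0) (h0 : N 0 w = 0) (h1 : N 1 w = 0) : False := by
  have hI : Complex.I ^ 2 = -1 := Complex.I_sq
  simp only [N, Matrix.cons_val] at h0 h1
  have e : w = 0 := by
    linear_combination (-Complex.I / 3) * h0 - (1 / 3) * h1 + (1 / 2) * (w - w ^ 5) * hI
  rw [e] at hD
  simp [D] at hD

lemma D'_ne (w : ℂ) (hD : D w = 0) : D' w ≠ 0 := by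
  intro h
  have hs := s_sq
  have e : w ^ 2 * (2 * w ^ 3 + s) = 0 := by
    simp only [D'] at h; linear_combination (1 / 3) * h
  rcases mul_eq_zero.1 e with h | h
  · have : w = 0 := pow_eq_zero_iff (by norm_num) |>.1 h
    rw [this] at hD
    simp [D] at hD
  · simp only [D] at hD
    have : (9 : ℂ) = 0 := by
      linear_combination -4 * hD + (2 * w ^ 3 + s) * h - hs
    norm_num at this

lemma null_zero (a b c : ℂ) (e : a ^ 2 + b ^ 2 + c ^ 2 = 0) (ha : a.re = 0) (hb : b.re = 0)
    (hc : c.re = 0) : a = 0 ∧ b = 0 := by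
  have := congrArg Complex.re e
  simp only [Complex.add_re, pow_two, Complex.mul_re, ha, hb, hc, Complex.zero_re] at this
  have h1 : a.im = 0 := by nlinarith [sq_nonneg a.im, sq_nonneg b.im, sq_nonneg c.im]
  have h2 : b.im = 0 := by nlinarith [sq_nonneg a.im, sq_nonneg b.im, sq_nonneg c.im]
  exact ⟨Complex.ext ha h1, Complex.ext hb h2⟩

lemma G_sq (w : ℂ) : 2 * (G 0 w ^ 2 + G 1 w ^ 2 + G 2 w ^ 2)
    = Q w * ((D w).re ^ 2 + (D w).im ^ 2) := by
  have h1 := congrArg Complex.re (N_sq w)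
  have h2 := congrArg Complex.im (N_sq w)
  simp only [Complex.add_re, Complex.add_im, pow_two, Complex.mul_re, Complex.mul_im] at h1 h2
  simp only [G, Q]
  linear_combination ((D w).re ^ 2 - (D w).im ^ 2) * h1 + 2 * (D w).re * (D w).im * h2

lemma poly_pos (r : ℝ) (h0 : 0 ≤ r) (h1 : r ≤ 1) :
    0 < 9 / 2 * (r ^ 2 + r ^ 10) - 3 / 2 * r ^ 6 + 1 / 2 * (1 + r ^ 12)
      - 5 * r ^ 3 * (1 - r ^ 6) := by
  have a : r ^ 10 ≤ r ^ 9 := pow_le_pow_of_le_one h0 h1 (by norm_num)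
  have b : 0 ≤ r ^ 2 * (r - 1) ^ 2 := by positivity
  have c : 0 ≤ r ^ 2 * (r ^ 4 - 1 / 2) ^ 2 := by positivity
  have d : 0 ≤ r ^ 2 * (r ^ 2 - 1) ^ 2 := by positivity
  have e : 0 ≤ (r ^ 2 - 1 / 4) ^ 2 := by positivity
  have f : 0 ≤ r ^ 12 := by positivity
  have g : 0 ≤ r ^ 10 := by positivity
  nlinarith

lemma Q_pos (w : ℂ) (hw : Complex.normSq w ≤ 1) : 0 < Q w := by
  have hs0 : Real.sqrt 5 ^ 2 = 5 := Real.sq_sqrt (by norm_num)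
  have hN01 : ((N 0 w).re ^ 2 + (N 0 w).im ^ 2) + ((N 1 w).re ^ 2 + (N 1 w).im ^ 2)
      = 9 / 2 * (Complex.normSq w + Complex.normSq w ^ 5) := by
    rw [← map_pow Complex.normSq w 5]
    simp only [N, Matrix.cons_val, Complex.normSq_apply]
    generalize w ^ 5 = q
    simp
    ring
  have hQ : Q w = 9 / 2 * (Complex.normSq w + Complex.normSq w ^ 5)
      + 3 * ((w ^ 3).re ^ 2 - (w ^ 3).im ^ 2) + 8 * (w ^ 3).re * (w ^ 3).im
      + 15 / 2 * Complex.normSq w ^ 3 + 1 / 2 * (1 + (Complex.normSq w ^ 3) ^ 2)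
      + Real.sqrt 5 * (1 - Complex.normSq w ^ 3) * (2 * (w ^ 3).im - (w ^ 3).re) := by
    rw [Q, hN01, ← map_pow Complex.normSq w 3]
    have h6 : w ^ 6 = w ^ 3 * w ^ 3 := by ring
    simp only [N, M, D, s, Matrix.cons_val, h6]
    rw [Complex.normSq_apply (w ^ 3)]
    generalize w ^ 3 = u
    simp
    generalize Real.sqrt 5 = t at *
    linear_combination (3 / 2 * (u.re ^ 2 + u.im ^ 2)) * hs0
  have hu : (w ^ 3).re ^ 2 + (w ^ 3).im ^ 2 = Complex.normSq w ^ 3 := by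
    rw [← map_pow, Complex.normSq_apply]; ring
  rw [hQ]
  have hr0 : 0 ≤ ‖w‖ := norm_nonneg w
  have hn : Complex.normSq w = ‖w‖ ^ 2 := Complex.normSq_eq_norm_sq w
  rw [hn] at hw hu ⊢
  generalize ‖w‖ = r at *
  have hr1 : r ≤ 1 := by nlinarith
  generalize (w ^ 3).re = a at *
  generalize (w ^ 3).im = b at *
  have hp := poly_pos r hr0 hr1
  have hb : -(5 * r ^ 3) ≤ Real.sqrt 5 * (2 * b - a) := by
    refine (abs_le_of_sq_le_sq' ?_ (by positivity)).1
    rw [mul_pow, hs0]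
    nlinarith [sq_nonneg (2 * a + b)]
  have hr6 : 0 ≤ 1 - (r ^ 2) ^ 3 := by
    have : (r ^ 2) ^ 3 ≤ 1 := pow_le_one₀ (by positivity) hw
    linarith
  have hm := mul_le_mul_of_nonneg_left hb hr6
  nlinarith [sq_nonneg (2 * a + 2 * b), sq_nonneg a, sq_nonneg b]

lemma smooth_pow (n : ℕ) : ContDiff ℝ (⊤ : ℕ∞) (fun w : ℂ => w ^ n) := by fun_prop

lemma smooth_D : ContDiff ℝ (⊤ : ℕ∞) D := by unfold D; fun_prop
lemma smooth_M : ContDiff ℝ (⊤ : ℕ∞) M := by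
  have := smooth_D
  unfold M; fun_prop
lemma smooth_N (k : Fin 3) : ContDiff ℝ (⊤ : ℕ∞) (N k) := by
  have := smooth_D
  fin_cases k <;> unfold N <;> simp <;> fun_prop
lemma smooth_re : ContDiff ℝ (⊤ : ℕ∞) Complex.re := Complex.reCLM.contDiff
lemma smooth_im : ContDiff ℝ (⊤ : ℕ∞) Complex.im := Complex.imCLM.contDiff

lemma smooth_G (k : Fin 3) : ContDiff ℝ (⊤ : ℕ∞) (G k) := by
  have h1 := smooth_re.comp smooth_D
  have h2 := smooth_im.comp smooth_D
  have h3 := smooth_re.comp (smooth_N k)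
  have h4 := smooth_im.comp (smooth_N k)
  exact (h3.mul h1).add (h4.mul h2)

lemma smooth_Q : ContDiff ℝ (⊤ : ℕ∞) Q := by
  have h1 := smooth_re.comp smooth_D
  have h2 := smooth_im.comp smooth_D
  have h3 := fun k => smooth_re.comp (smooth_N k)
  have h4 := fun k => smooth_im.comp (smooth_N k)
  have h5 := smooth_re.comp smooth_M
  have h6 := smooth_im.comp smooth_M
  exact (((((h3 0).pow 2).add ((h4 0).pow 2)).add (((h3 1).pow 2).add ((h4 1).pow 2))).add
    (((h3 2).pow 2).add ((h4 2).pow 2))).add ((h5.mul h1).add (h6.mul h2))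

lemma smooth_h (w : ℂ) (hw : Q w ≠ 0) : ContDiffAt ℝ (⊤ : ℕ∞) h w := by
  rw [contDiffAt_euclidean]
  intro k
  exact ((contDiff_const.mul (smooth_G k)).contDiffAt).div smooth_Q.contDiffAt hw

lemma h_apply (w : ℂ) (k : Fin 3) : h w k = 2 * G k w / Q w := rfl

/-- Main immersion property in the chart. -/
lemma key (w : ℂ) (hQ : Q w ≠ 0) (v : ℂ) (hv : fderiv ℝ h w v = 0) : v = 0 := by
  have hd : HasFDerivAt h (fderiv ℝ h w) w :=
    ((smooth_h w hQ).differentiableAt (by simp)).hasFDerivAt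
  have hk : ∀ k : Fin 3, HasFDerivAt (fun z => h z k)
      ((EuclideanSpace.proj k : E3 →L[ℝ] ℝ).comp (fderiv ℝ h w)) w := fun k =>
    (EuclideanSpace.proj k : E3 →L[ℝ] ℝ).hasFDerivAt.comp w hd
  have hD' : HasFDerivAt D _ w := (hasDerivAt_D w).hasFDerivAt.restrictScalars ℝ
  have hN' : ∀ k, HasFDerivAt (N k) _ w :=
    fun k => (hasDerivAt_N k w).hasFDerivAt.restrictScalars ℝ
  have hQ' : HasFDerivAt Q (fderiv ℝ Q w) w :=
    (smooth_Q.contDiffAt.differentiableAt (by simp)).hasFDerivAt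
  have hQev : ∀ᶠ z in nhds w, Q z ≠ 0 := smooth_Q.continuous.continuousAt.eventually_ne hQ
  by_cases hD : D w = 0
  · have hz : ∀ k, ((N k w) * (starRingEnd ℂ) (D' w * v)).re = 0 := by
      intro k
      have e1 : HasFDerivAt (G k) _ w :=
        ((Complex.reCLM.hasFDerivAt.comp w (hN' k)).mul (Complex.reCLM.hasFDerivAt.comp w hD')).add
        ((Complex.imCLM.hasFDerivAt.comp w (hN' k)).mul (Complex.imCLM.hasFDerivAt.comp w hD'))
      have e2 := ((hk k).mul hQ').const_mul (1 / 2 : ℝ)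
      have e3 : (fun z => (1 / 2 : ℝ) * (h z k * Q z)) =ᶠ[nhds w] G k := by
        filter_upwards [hQev] with z hz
        rw [h_apply]; field_simp
      have e4 := (e2.congr_of_eventuallyEq e3.symm).unique e1
      have e5 := congrArg (fun L => L v) e4
      have hh : h w k = 0 := by rw [h_apply]; simp [G, hD]
      simp [hv, hh, hD] at e5
      simp
      linarith
    have hn : (N 0 w * (starRingEnd ℂ) (D' w * v)) ^ 2 + (N 1 w * (starRingEnd ℂ) (D' w * v)) ^ 2
        + (N 2 w * (starRingEnd ℂ) (D' w * v)) ^ 2 = 0 := by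
      have := N_sq w
      rw [hD, zero_mul] at this
      linear_combination ((starRingEnd ℂ) (D' w * v)) ^ 2 * this
    obtain ⟨a, b⟩ := null_zero _ _ _ hn (hz 0) (hz 1) (hz 2)
    by_contra hv0
    have : (starRingEnd ℂ) (D' w * v) ≠ 0 := by
      simpa using ⟨D'_ne w hD, hv0⟩
    exact N_ne w hD ((mul_eq_zero.1 a).resolve_right this) ((mul_eq_zero.1 b).resolve_right this)
  · have hDev : ∀ᶠ z in nhds w, D z ≠ 0 := smooth_D.continuous.continuousAt.eventually_ne hD
    have hz : ∀ k, (W k w * (v / D w ^ 2)).re = 0 := by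
      intro k
      have e1 : HasFDerivAt (fun z => (N k z / D z).re) _ w :=
        Complex.reCLM.hasFDerivAt.comp w
          (((hasDerivAt_N k w).div (hasDerivAt_D w) hD).hasFDerivAt.restrictScalars ℝ)
      have hns : ∀ z, Q z ≠ 0 → D z ≠ 0 → h z 0 ^ 2 + h z 1 ^ 2 + h z 2 ^ 2 =
          2 * ((D z).re ^ 2 + (D z).im ^ 2) / Q z ∧ (D z).re ^ 2 + (D z).im ^ 2 ≠ 0 := by
        intro z hz1 hz2
        constructor
        · simp only [h_apply]
          field_simp
          linear_combination G_sq z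
        · have := Complex.normSq_pos.2 hz2
          rw [Complex.normSq_apply] at this
          nlinarith
      have hne : h w 0 ^ 2 + h w 1 ^ 2 + h w 2 ^ 2 ≠ 0 := by
        obtain ⟨a, b⟩ := hns w hQ hD
        rw [a]
        positivity
      have e2 := (hk k).mul ((hasDerivAt_inv hne).hasFDerivAt.comp w
        ((((hk 0).pow 2).add ((hk 1).pow 2)).add ((hk 2).pow 2)))
      have e3 : (fun z => (N k z / D z).re) =ᶠ[nhds w]
          (fun z => h z k * (h z 0 ^ 2 + h z 1 ^ 2 + h z 2 ^ 2)⁻¹) := by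
        filter_upwards [hQev, hDev] with z h1 h2
        obtain ⟨a, b⟩ := hns z h1 h2
        rw [a, h_apply, Complex.div_re, Complex.normSq_apply, G]
        have b' : (D z).re * (D z).re + (D z).im * (D z).im ≠ 0 := by
          simpa [pow_two] using b
        field_simp
      have e4 := (e2.congr_of_eventuallyEq e3).unique e1
      have e5 := congrArg (fun L => L v) e4
      simp [hv] at e5
      have e6 : W k w * (v / D w ^ 2) = v * ((N' k w * D w - N k w * D' w) / D w ^ 2) := by
        rw [W]; ring
      rw [e6, Complex.mul_re]
      linarith
    have hn : (W 0 w * (v / D w ^ 2)) ^ 2 + (W 1 w * (v / D w ^ 2)) ^ 2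
        + (W 2 w * (v / D w ^ 2)) ^ 2 = 0 := by
      linear_combination (v / D w ^ 2) ^ 2 * W_sq w
    obtain ⟨a, b⟩ := null_zero _ _ _ hn (hz 0) (hz 1) (hz 2)
    by_contra hv0
    have : v / D w ^ 2 ≠ 0 := by positivity
    exact W_ne w hD (by simpa [this] using a) (by simpa [this] using b)

lemma conj_s : (starRingEnd ℂ) s = s := Complex.conj_ofReal _

lemma D_anti (w z : ℂ) (hz : z * (starRingEnd ℂ) w = -1) :
    D z * (starRingEnd ℂ) w ^ 6 = -(starRingEnd ℂ) (D w) := by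
  simp only [D, map_sub, map_add, map_mul, map_pow, map_one, conj_s]
  generalize (starRingEnd ℂ) w = c at *
  have h3 : z ^ 3 * c ^ 3 = -1 := by rw [← mul_pow, hz]; norm_num
  have h6 : z ^ 6 * c ^ 6 = 1 := by rw [← mul_pow, hz]; norm_num
  linear_combination h6 + s * c ^ 3 * h3

lemma M_anti (w z : ℂ) (hz : z * (starRingEnd ℂ) w = -1) :
    M z * (starRingEnd ℂ) w ^ 6 = -(starRingEnd ℂ) (M w) := by
  have hD := D_anti w z hz
  simp only [M, map_sub, map_add, map_mul, map_pow, map_one, conj_s, map_neg, Complex.conj_I,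
    map_div₀, map_ofNat]
  generalize (starRingEnd ℂ) w = c at *
  have h3 : z ^ 3 * c ^ 3 = -1 := by rw [← mul_pow, hz]; norm_num
  have h6 : z ^ 6 * c ^ 6 = 1 := by rw [← mul_pow, hz]; norm_num
  linear_combination (Complex.I - 1) * h6 + s * c ^ 3 * h3 + (1 / 4) * hD

lemma N_anti (k : Fin 3) (w z : ℂ) (hz : z * (starRingEnd ℂ) w = -1) :
    N k z * (starRingEnd ℂ) w ^ 6 = -(starRingEnd ℂ) (N k w) := by
  have hD := D_anti w z hz
  have h5 : z ^ 5 * (starRingEnd ℂ) w ^ 5 = -1 := by rw [← mul_pow, hz]; norm_num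
  have h6 : z ^ 6 * (starRingEnd ℂ) w ^ 6 = 1 := by rw [← mul_pow, hz]; norm_num
  fin_cases k
  · simp [N, Complex.conj_ofNat]
    generalize (starRingEnd ℂ) w = c at *
    linear_combination (3 / 2) * Complex.I * (c ^ 5 * hz - c * h5)
  · simp [N, Complex.conj_ofNat]
    generalize (starRingEnd ℂ) w = c at *
    linear_combination -(3 / 2) * (c ^ 5 * hz + c * h5)
  · simp [N, Complex.conj_ofNat]
    generalize (starRingEnd ℂ) w = c at *
    linear_combination -Complex.I * h6 - (1 / 2) * hD

lemma pair_anti (A B A' B' c : ℂ) (hA : A' * c = -(starRingEnd ℂ) A)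
    (hB : B' * c = -(starRingEnd ℂ) B) :
    (A'.re * B'.re + A'.im * B'.im) * (c.re ^ 2 + c.im ^ 2) = A.re * B.re + A.im * B.im := by
  have a1 := congrArg Complex.re hA
  have a2 := congrArg Complex.im hA
  have b1 := congrArg Complex.re hB
  have b2 := congrArg Complex.im hB
  simp at a1 a2 b1 b2
  have e : A.re * B.re + A.im * B.im = (-A.re) * (-B.re) + A.im * B.im := by ring
  rw [e, ← a1, ← b1, ← a2, ← b2]
  ring

lemma h_anti (w z : ℂ) (hz : z * (starRingEnd ℂ) w = -1) : h z = h w := by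
  set c := (starRingEnd ℂ) w ^ 6 with hc
  have hc0 : c.re ^ 2 + c.im ^ 2 ≠ 0 := by
    have : c ≠ 0 := by
      rw [hc]
      refine pow_ne_zero _ ?_
      intro h0
      rw [h0] at hz
      simp at hz
    have := Complex.normSq_pos.2 this
    rw [Complex.normSq_apply] at this
    nlinarith
  have hG : ∀ k, G k w = G k z * (c.re ^ 2 + c.im ^ 2) := fun k =>
    (pair_anti _ _ _ _ c (N_anti k w z hz) (D_anti w z hz)).symm
  have hQ : Q w = Q z * (c.re ^ 2 + c.im ^ 2) := by
    have e := fun k => pair_anti _ _ _ _ c (N_anti k w z hz) (N_anti k w z hz)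
    have e4 := pair_anti _ _ _ _ c (M_anti w z hz) (D_anti w z hz)
    simp only [Q]
    linear_combination -e 0 - e 1 - e 2 - e4
  ext k
  rw [h_apply, h_apply, hG, hQ, ← mul_assoc, mul_div_mul_right _ _ hc0]

/-- Stereographic projection. -/
def st (x : E3) : ℂ := ⟨x 0 / (1 - x 2), x 1 / (1 - x 2)⟩

def F (x : E3) : E3 := h (st x)

lemma F_neg (x : E3) (hx : x 0 ^ 2 + x 1 ^ 2 + x 2 ^ 2 = 1) : F (-x) = F x := by
  unfold F
  by_cases h2 : x 0 ^ 2 + x 1 ^ 2 = 0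
  · have h0 : x 0 = 0 := by nlinarith [sq_nonneg (x 0), sq_nonneg (x 1)]
    have h1 : x 1 = 0 := by nlinarith [sq_nonneg (x 0), sq_nonneg (x 1)]
    congr 1
    simp [st, h0, h1]
  · have ha : 1 - x 2 ≠ 0 := by
      intro h; apply h2; linear_combination hx + (1 + x 2) * h
    have hb : 1 + x 2 ≠ 0 := by
      intro h; apply h2; linear_combination hx + (1 - x 2) * h
    apply h_anti
    apply Complex.ext
    · simp [st]
      field_simp
      linear_combination -hx
    · simp [st]
      field_simp
      ring

lemma st_smooth (x : E3) (hx : 1 - x 2 ≠ 0) : ContDiffAt ℝ (⊤ : ℕ∞) st x := by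
  have e : st = fun x : E3 => Complex.equivRealProdCLM.symm
    (x 0 / (1 - x 2), x 1 / (1 - x 2)) := by
    funext x
    apply Complex.ext <;> simp [st]
  rw [e]
  have hp : ∀ k : Fin 3, ContDiffAt ℝ (⊤ : ℕ∞) (fun x : E3 => x k) x := fun k =>
    (EuclideanSpace.proj k : E3 →L[ℝ] ℝ).contDiff.contDiffAt
  exact Complex.equivRealProdCLM.symm.contDiff.contDiffAt.comp x
    (((hp 0).div (contDiffAt_const.sub (hp 2)) hx).prodMk
      ((hp 1).div (contDiffAt_const.sub (hp 2)) hx))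

lemma st_inj (x : E3) (hx : 1 - x 2 ≠ 0) (hx1 : x 0 ^ 2 + x 1 ^ 2 + x 2 ^ 2 = 1) (y : E3)
    (hy : x 0 * y 0 + x 1 * y 1 + x 2 * y 2 = 0) (h : fderiv ℝ st x y = 0) : y = 0 := by
  have hd : HasFDerivAt st (fderiv ℝ st x) x :=
    ((st_smooth x hx).differentiableAt (by simp)).hasFDerivAt
  have hp : ∀ k : Fin 3, HasFDerivAt (fun x : E3 => x k) (EuclideanSpace.proj k : E3 →L[ℝ] ℝ) x :=
    fun k => (EuclideanSpace.proj k : E3 →L[ℝ] ℝ).hasFDerivAt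
  have hev : ∀ᶠ z : E3 in nhds x, 1 - z 2 ≠ 0 :=
    ((hp 2).continuousAt.const_sub 1 : ContinuousAt (fun z : E3 => 1 - z 2) x).eventually_ne hx
  have a0 : y 0 * (1 - x 2) + x 0 * y 2 = 0 := by
    have e1 := (Complex.reCLM.hasFDerivAt.comp x hd).mul ((hp 2).const_sub 1)
    have e2 := (e1.congr_of_eventuallyEq (f₁ := fun z : E3 => z 0) (by
      filter_upwards [hev] with z hz
      simp [st]; field_simp)).unique (hp 0)
    have e3 := congrArg (fun L => L y) e2
    simp [h, st] at e3
    rw [← e3]; field_simp; ring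
  have a1 : y 1 * (1 - x 2) + x 1 * y 2 = 0 := by
    have e1 := (Complex.imCLM.hasFDerivAt.comp x hd).mul ((hp 2).const_sub 1)
    have e2 := (e1.congr_of_eventuallyEq (f₁ := fun z : E3 => z 1) (by
      filter_upwards [hev] with z hz
      simp [st]; field_simp)).unique (hp 1)
    have e3 := congrArg (fun L => L y) e2
    simp [h, st] at e3
    rw [← e3]; field_simp; ring
  have b2 : y 2 = 0 := by
    have : (1 - x 2) * y 2 = 0 := by
      linear_combination x 0 * a0 + x 1 * a1 - (1 - x 2) * hy - y 2 * hx1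
    exact (mul_eq_zero.1 this).resolve_left hx
  rw [b2, mul_zero, add_zero] at a0 a1
  ext k
  fin_cases k
  · exact (mul_eq_zero.1 a0).resolve_right hx
  · exact (mul_eq_zero.1 a1).resolve_right hx
  · exact b2

lemma sphere_eq (x : S2) : (x : E3) 0 ^ 2 + (x : E3) 1 ^ 2 + (x : E3) 2 ^ 2 = 1 := by
  have := EuclideanSpace.real_norm_sq_eq (x : E3)
  rw [norm_eq_of_mem_sphere] at this
  simpa [Fin.sum_univ_three] using this.symm

lemma st_Q (x : S2) (hx : (x : E3) 2 ≤ 0) : Q (st x) ≠ 0 := by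
  refine (Q_pos _ ?_).ne'
  have h1 := sphere_eq x
  have h2 : (0 : ℝ) < 1 - (x : E3) 2 := by linarith
  have : Complex.normSq (st x) = ((x : E3) 0 ^ 2 + (x : E3) 1 ^ 2) / (1 - (x : E3) 2) ^ 2 := by
    simp [Complex.normSq_apply, st]; field_simp
  rw [this, div_le_one (by positivity)]
  nlinarith

lemma F_smooth (x : S2) (hx : (x : E3) 2 ≤ 0) : ContDiffAt ℝ (⊤ : ℕ∞) F x :=
  (smooth_h _ (st_Q x hx)).comp (x : E3) (st_smooth x (by linarith))

def f (x : S2) : E3 := F x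

lemma f_neg (x : S2) : f (-x) = f x := F_neg _ (sphere_eq x)


instance : Fact (Module.finrank ℝ E3 = 2 + 1) := ⟨by simp⟩

lemma f_smooth_half (x : S2) (hx : (x : E3) 2 ≤ 0) :
    ContMDiffAt (𝓡 2) 𝓘(ℝ, E3) (⊤ : ℕ∞) f x :=
  (F_smooth x hx).contMDiffAt.comp x (contMDiff_coe_sphere.contMDiffAt)

lemma f_inj_half (x : S2) (hx : (x : E3) 2 ≤ 0) :
    Function.Injective (mfderiv (𝓡 2) 𝓘(ℝ, E3) f x) := by
  have hFd : DifferentiableAt ℝ F x := (F_smooth x hx).differentiableAt (by simp)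
  have hcd : MDifferentiableAt (𝓡 2) 𝓘(ℝ, E3) ((↑) : S2 → E3) x :=
    (contMDiff_coe_sphere (m := (⊤ : ℕ∞))).contMDiffAt.mdifferentiableAt (by simp)
  have e : mfderiv (𝓡 2) 𝓘(ℝ, E3) f x = (mfderiv 𝓘(ℝ, E3) 𝓘(ℝ, E3) F (x : E3)).comp
      (mfderiv (𝓡 2) 𝓘(ℝ, E3) ((↑) : S2 → E3) x) :=
    mfderiv_comp x hFd.mdifferentiableAt hcd
  rw [e, mfderiv_eq_fderiv]
  have hst : (1 : ℝ) - (x : E3) 2 ≠ 0 := by linarith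
  have eF : fderiv ℝ F x = (fderiv ℝ h (st x)).comp (fderiv ℝ st x) :=
    fderiv_comp (x : E3) ((smooth_h _ (st_Q x hx)).differentiableAt (by simp))
      ((st_smooth _ hst).differentiableAt (by simp))
  rw [eF]
  intro a b hab
  let c : TangentSpace (𝓡 2) x →L[ℝ] E3 := mfderiv (𝓡 2) 𝓘(ℝ, E3) ((↑) : S2 → E3) x
  have hab' : fderiv ℝ h (st x) (fderiv ℝ st x (c a)) = fderiv ℝ h (st x) (fderiv ℝ st x (c b)) :=
    hab
  obtain ⟨y, hy⟩ : ∃ y : E3, y = c (a - b) := ⟨_, rfl⟩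
  have hv' : fderiv ℝ h (st x) (fderiv ℝ st x y) = 0 := by
    rw [hy, map_sub, map_sub, map_sub, hab', sub_self]
  have h1 := key _ (st_Q x hx) _ hv'
  have hmem : y ∈ (Submodule.span ℝ {(x : E3)})ᗮ := by
    rw [← range_mfderiv_coe_sphere (n := 2) x]
    exact ⟨a - b, hy.symm⟩
  have hin := Submodule.mem_orthogonal_singleton_iff_inner_right.1 hmem
  have h2 : y = 0 := by
    refine st_inj x hst (sphere_eq x) y ?_ h1
    rw [PiLp.inner_apply, Fin.sum_univ_three] at hin
    simp at hin
    linarith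
  rw [h2, map_sub] at hy
  exact mfderiv_coe_sphere_injective (n := 2) x (sub_eq_zero.1 hy.symm)

lemma f_comp_neg : f = f ∘ (fun x : S2 => -x) := by
  funext x; exact (f_neg x).symm

lemma f_smooth (x : S2) : ContMDiffAt (𝓡 2) 𝓘(ℝ, E3) (⊤ : ℕ∞) f x := by
  rcases le_total ((x : E3) 2) 0 with hx | hx
  · exact f_smooth_half x hx
  · rw [f_comp_neg]
    exact (f_smooth_half (-x) (by simpa using hx)).comp x contMDiff_neg_sphere.contMDiffAt

lemma f_inj (x : S2) : Function.Injective (mfderiv (𝓡 2) 𝓘(ℝ, E3) f x) := by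
  rcases le_total ((x : E3) 2) 0 with hx | hx
  · exact f_inj_half x hx
  · have hn : ∀ y : S2, MDifferentiableAt (𝓡 2) (𝓡 2) (fun x : S2 => -x) y := fun y =>
      (contMDiff_neg_sphere (m := (⊤ : ℕ∞))).contMDiffAt.mdifferentiableAt (by simp)
    have hf : ∀ y : S2, MDifferentiableAt (𝓡 2) 𝓘(ℝ, E3) f y := fun y =>
      (f_smooth y).mdifferentiableAt (by simp)
    have e1 : mfderiv (𝓡 2) 𝓘(ℝ, E3) f x = (mfderiv (𝓡 2) 𝓘(ℝ, E3) f (-x)).comp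
        (mfderiv (𝓡 2) (𝓡 2) (fun x : S2 => -x) x) := by
      conv_lhs => rw [f_comp_neg]
      exact mfderiv_comp x (hf _) (hn x)
    have e2 : (mfderiv (𝓡 2) (𝓡 2) (fun x : S2 => -x) (-x)).comp
        (mfderiv (𝓡 2) (𝓡 2) (fun x : S2 => -x) x) = ContinuousLinearMap.id ℝ _ := by
      rw [← mfderiv_comp x (hn (-x)) (hn x)]
      have : (fun x : S2 => -x) ∘ (fun x : S2 => -x) = id := by funext y; simp
      rw [this]
      exact mfderiv_id
    rw [e1]
    have e3 := f_inj_half (-x) (by simpa using hx)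
    refine e3.comp ?_
    apply Function.LeftInverse.injective
      (g := mfderiv (𝓡 2) (𝓡 2) (fun x : S2 => -x) (-x))
    intro v
    exact congrArg (fun L => L v) e2

end Boy

/-- Existence of a Boy-type halfway model: there is a smooth immersion of `S²`
into `ℝ³` invariant under the antipodal map, i.e. a double cover of an immersed
real projective plane (a Boy's surface). -/
theorem exists_boys_surface_halfway_model :
    ∃ f : S2 → E3, IsImmersion f ∧ ∀ x : S2, f (-x) = f x := by
  exact ⟨Boy.f, ⟨Boy.f_smooth, Boy.f_inj⟩, Boy.f_neg⟩
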